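/- arXiv:2004.12224 — 2 statements merged into one kernel-verified Lean document; each statement's English description precedes it below -/
import Mathlib

section
/- Let h : 2^I → ℝ be a submodular set function on subsets of a finite ground set I with h(∅) ≥ 0, and let S_1, …, S_N ⊆ I (N ≥ 1) be pairwise disjoint sets. Then there exists 1 ≤ r* ≤ N such that h(∪_{1 ≤ r ≤ N, r ≠ r*} S_r) ≥ (1 − 1/N) · h(S_1 ∪ … ∪ S_N). -/
open Finset in
theorem biUnion_sdiff_inter_biUnion_erase {ι κ : Type*} [DecidableEq ι] [DecidableEq κ]
    {S : κ → Finset ι} (hdisj : ∀ r r' : κ, r ≠ r' → Disjoint (S r) (S r'))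
    (s t : Finset κ) (a : κ) :
    (s \ t).biUnion S ∩ (s.erase a).biUnion S = (s \ insert a t).biUnion S := by
  ext x
  simp only [mem_inter, mem_biUnion, mem_sdiff, mem_erase, mem_insert, not_or]
  constructor
  · rintro ⟨⟨i, ⟨his, hit⟩, hxi⟩, j, ⟨hja, -⟩, hxj⟩
    obtain rfl : i = j := by
      by_contra hij
      exact disjoint_left.mp (hdisj i j hij) hxi hxj
    exact ⟨i, ⟨his, hja, hit⟩, hxi⟩
  · rintro ⟨i, ⟨his, hia, hit⟩, hxi⟩
    exact ⟨⟨i, ⟨his, hit⟩, hxi⟩, i, ⟨hia, his⟩, hxi⟩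

open Finset in
theorem biUnion_sdiff_union_biUnion_erase {ι κ : Type*} [DecidableEq ι] [DecidableEq κ]
    (S : κ → Finset ι) {s t : Finset κ} {a : κ} (hat : a ∉ t) :
    (s \ t).biUnion S ∪ (s.erase a).biUnion S = s.biUnion S := by
  rw [← union_biUnion]
  congr 1
  grind

open Finset in
/-- Dropping the members of a disjoint family one at a time from its union loses, in total, at most
what dropping them all at once loses. -/
theorem card_mul_add_le_sum_erase_of_submodular {ι κ : Type*} [DecidableEq ι] [DecidableEq κ]
    {h : Finset ι → ℝ} (hsub : ∀ A B : Finset ι, h (A ∪ B) + h (A ∩ B) ≤ h A + h B)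
    {S : κ → Finset ι} (hdisj : ∀ r r' : κ, r ≠ r' → Disjoint (S r) (S r'))
    (s t : Finset κ) :
    #t * h (s.biUnion S) + h ((s \ t).biUnion S) ≤
      ∑ r ∈ t, h ((s.erase r).biUnion S) + h (s.biUnion S) := by
  induction t using Finset.induction_on with
  | empty => simp
  | insert a t hat ih =>
    have hsub' := hsub ((s \ t).biUnion S) ((s.erase a).biUnion S)
    rw [biUnion_sdiff_union_biUnion_erase S hat,
      biUnion_sdiff_inter_biUnion_erase hdisj] at hsub'
    rw [sum_insert hat, card_insert_of_notMem hat]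
    push_cast
    linarith

/-- For a submodular h with h(∅) ≥ 0 and pairwise disjoint sets
S_1, …, S_N, some S_{r*} can be dropped while keeping a (1 - 1/N) fraction
of the value. -/
theorem stmt_3 {ι : Type} [DecidableEq ι]
    (h : Finset ι → ℝ)
    (hsub : ∀ A B : Finset ι, h (A ∪ B) + h (A ∩ B) ≤ h A + h B)
    (h0 : 0 ≤ h ∅)
    (N : ℕ) (hN : 1 ≤ N)
    (S : Fin N → Finset ι)
    (hdisj : ∀ r r' : Fin N, r ≠ r' → Disjoint (S r) (S r')) :
    ∃ rstar : Fin N,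
      (1 - 1 / (N : ℝ)) * h (Finset.univ.biUnion S) ≤
        h ((Finset.univ.erase rstar).biUnion S) := by
  by_contra! hlt
  have : NeZero N := ⟨by omega⟩
  have hN0 : (N : ℝ) ≠ 0 := NeZero.ne _
  have hle := card_mul_add_le_sum_erase_of_submodular hsub hdisj Finset.univ Finset.univ
  have hsum := Finset.sum_lt_sum_of_nonempty Finset.univ_nonempty fun r _ => hlt r
  simp only [Finset.sdiff_self, Finset.biUnion_empty, Finset.card_univ, Fintype.card_fin] at hle
  rw [Finset.sum_const, Finset.card_univ, Fintype.card_fin, nsmul_eq_mul, ← mul_assoc,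
    mul_sub, mul_one_div_cancel hN0] at hsum
  linarith
end

section
/- Let f : 2^I → ℝ be a non-negative, monotone and submodular function on subsets of a finite ground set I, let A ⊆ I with |A| = r ≥ 1, and let a_1, …, a_r be an enumeration of A such that, setting T_0 = ∅ and T_ℓ = {a_1, …, a_ℓ}, for every 1 ≤ ℓ ≤ r the element a_ℓ maximizes f(T_{ℓ−1} ∪ {a}) − f(T_{ℓ−1}) over a ∈ A \ T_{ℓ−1}. Then for every 1 ≤ ξ ≤ r and every ξ < i ≤ r, ξ · (f(T_ξ ∪ {a_i}) − f(T_ξ)) ≤ f(T_ξ). -/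
theorem marginal_le_of_subset {ι : Type*} [DecidableEq ι] {f : Finset ι → ℝ}
    (hfsub : ∀ A B : Finset ι, f (A ∪ B) + f (A ∩ B) ≤ f A + f B)
    {S T : Finset ι} (hST : S ⊆ T) {x : ι} (hx : x ∉ T) :
    f (T ∪ {x}) - f T ≤ f (S ∪ {x}) - f S := by
  have hunion : (S ∪ {x}) ∪ T = T ∪ {x} := by grind
  have hinter : (S ∪ {x}) ∩ T = S := by grind
  have h := hfsub (S ∪ {x}) T
  rw [hunion, hinter] at h
  linarith

/-- for a greedy ordering a_1, …, a_r of a set A by marginal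
values, every later element i > ξ has marginal value w.r.t. T_ξ at most
f(T_ξ)/ξ, i.e. ξ·(f(T_ξ ∪ {a_i}) − f(T_ξ)) ≤ f(T_ξ). -/
theorem stmt_9 {ι : Type} [DecidableEq ι]
    (f : Finset ι → ℝ)
    (hf0 : ∀ A : Finset ι, 0 ≤ f A)
    (hfmono : ∀ A B : Finset ι, A ⊆ B → f A ≤ f B)
    (hfsub : ∀ A B : Finset ι, f (A ∪ B) + f (A ∩ B) ≤ f A + f B)
    (A : Finset ι) (r : ℕ) (hr : 1 ≤ r) (hcard : A.card = r)
    (a : ℕ → ι)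
    (hinj : ∀ ℓ ∈ Finset.Icc 1 r, ∀ ℓ' ∈ Finset.Icc 1 r, a ℓ = a ℓ' → ℓ = ℓ')
    (himg : (Finset.Icc 1 r).image a = A)
    (hgreedy : ∀ ℓ, 1 ≤ ℓ → ℓ ≤ r →
      ∀ x ∈ A \ (Finset.Icc 1 (ℓ - 1)).image a,
        f ((Finset.Icc 1 (ℓ - 1)).image a ∪ {x}) -
            f ((Finset.Icc 1 (ℓ - 1)).image a) ≤
          f ((Finset.Icc 1 (ℓ - 1)).image a ∪ {a ℓ}) -
            f ((Finset.Icc 1 (ℓ - 1)).image a))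
    (ξ : ℕ) (hξ1 : 1 ≤ ξ) (hξr : ξ ≤ r)
    (i : ℕ) (hi1 : ξ < i) (hi2 : i ≤ r) :
    (ξ : ℝ) * (f ((Finset.Icc 1 ξ).image a ∪ {a i}) -
        f ((Finset.Icc 1 ξ).image a)) ≤
      f ((Finset.Icc 1 ξ).image a) := by
  have hnotMem : ∀ k ≤ ξ, a i ∉ (Finset.Icc 1 k).image a := by
    intro k hk hmem
    obtain ⟨j, hj, hji⟩ := Finset.mem_image.mp hmem
    rw [Finset.mem_Icc] at hj
    have := hinj j (Finset.mem_Icc.mpr ⟨hj.1, by omega⟩) i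
      (Finset.mem_Icc.mpr ⟨by omega, hi2⟩) hji
    omega
  have hiA : a i ∈ A :=
    himg ▸ Finset.mem_image_of_mem a (Finset.mem_Icc.mpr ⟨by omega, hi2⟩)
  suffices h : ∀ k ≤ ξ, (k : ℝ) * (f ((Finset.Icc 1 ξ).image a ∪ {a i}) -
      f ((Finset.Icc 1 ξ).image a)) ≤ f ((Finset.Icc 1 k).image a) from h ξ le_rfl
  intro k
  induction k with
  | zero => intro _; simpa using hf0 ∅
  | succ k ih =>
    intro hk
    have hgain := hgreedy (k + 1) (by omega) (by omega) (a i)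
      (Finset.mem_sdiff.mpr ⟨hiA, hnotMem k (by omega)⟩)
    have hsucc : (Finset.Icc 1 k).image a ∪ {a (k + 1)} = (Finset.Icc 1 (k + 1)).image a := by
      rw [← Finset.insert_Icc_right_eq_Icc_add_one (by omega), Finset.image_insert,
        Finset.insert_eq, Finset.union_comm]
    rw [Nat.add_sub_cancel, hsucc] at hgain
    have hmarginal := marginal_le_of_subset hfsub
      (Finset.image_subset_image (f := a)
        (Finset.Icc_subset_Icc_right (a := 1) (show k ≤ ξ by omega))) (hnotMem ξ le_rfl)
    have hk' := ih (by omega)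
    push_cast
    linarith
end
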